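/- For every Schwartz function f : ℝ → ℂ, the iterated improper integral satisfies the exact identity (1/(√8 π)) ∫_0^∞ ∫_ℝ ( f̂(ξ) / √(iξ+0) ) e^{-ixξ} dξ dx = (1/π) ∫_0^∞ √x · f(−x) dx. -/

import Mathlib

open MeasureTheory Complex Filter Set

noncomputable section

/-- `√(iξ+0)`: the square root of `iξ` with the branch determined by
`arg(iξ+0) = π/2` for `ξ > 0` and `−π/2` for `ξ < 0`; equivalently
`√(iξ+0) = √|ξ| · e^{iπ·sgn(ξ)/4}`. -/
def sqrtIPlusZero (ξ : ℝ) : ℂ :=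
  (Real.sqrt |ξ| : ℂ) * Complex.exp (Complex.I * (Real.pi : ℂ) * (Real.sign ξ : ℂ) / 4)

/-- The Fourier transform `f̂(ξ) = (2π)^{-1/2} ∫ f(t) e^{-iξt} dt`. -/
def fourierHat (f : ℝ → ℂ) (ξ : ℝ) : ℂ :=
  (((2 * Real.pi : ℝ) ^ (-(1 : ℝ) / 2) : ℝ) : ℂ) *
    ∫ t : ℝ, f t * Complex.exp (-Complex.I * (ξ : ℂ) * (t : ℂ))

lemma tii_decay (f : SchwartzMap ℝ ℂ) :
    ∃ C : ℝ, 0 ≤ C ∧ ∀ v : ℝ, 0 ≤ v → ‖f (-v)‖ ≤ C * ((1 + v) ^ 3)⁻¹ := by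
  have h := SchwartzMap.one_add_le_sup_seminorm_apply (𝕜 := ℝ) (m := (3, 0)) (k := 3) (n := 0)
    le_rfl le_rfl f
  refine ⟨_, le_trans (by positivity) (h 0), fun v hv => ?_⟩
  have h2 := h (-v)
  simp only [norm_iteratedFDeriv_zero, norm_neg, Real.norm_of_nonneg hv] at h2
  rw [← div_eq_mul_inv, le_div_iff₀ (by positivity), mul_comm]
  exact h2

lemma tii_intP : Integrable (fun x : ℝ => |x| ^ (-(1/2) : ℝ) * (1 + |x|)⁻¹) := by
  have h0 : IntegrableOn (fun x : ℝ => |x| ^ (-(1/2) : ℝ) * (1 + |x|)⁻¹) (Ioi 0) := by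
    have hm : Measurable (fun x : ℝ => |x| ^ (-(1/2) : ℝ) * (1 + |x|)⁻¹) := by fun_prop
    rw [← Ioc_union_Ioi_eq_Ioi (zero_le_one' ℝ)]
    refine IntegrableOn.union ?_ ?_
    · have h1 : IntegrableOn (fun x : ℝ => x ^ (-(1/2) : ℝ)) (Ioc 0 1) := by
        rw [← intervalIntegrable_iff_integrableOn_Ioc_of_le zero_le_one]
        exact intervalIntegral.intervalIntegrable_rpow' (by norm_num)
      refine Integrable.mono' h1 hm.aestronglyMeasurable ?_
      filter_upwards [ae_restrict_mem measurableSet_Ioc] with x hx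
      have hx0 : 0 < x := hx.1
      rw [abs_of_pos hx0, Real.norm_of_nonneg (by positivity)]
      exact mul_le_of_le_one_right (by positivity) (inv_le_one_of_one_le₀ (by linarith))
    · have h1 : IntegrableOn (fun x : ℝ => x ^ (-(3/2) : ℝ)) (Ioi 1) :=
        integrableOn_Ioi_rpow_of_lt (by norm_num) one_pos
      refine Integrable.mono' h1 hm.aestronglyMeasurable ?_
      filter_upwards [ae_restrict_mem measurableSet_Ioi] with x hx
      have hx0 : 0 < x := lt_trans one_pos hx
      rw [abs_of_pos hx0, Real.norm_of_nonneg (by positivity)]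
      have : x ^ (-(3/2) : ℝ) = x ^ (-(1/2) : ℝ) * x⁻¹ := by
        rw [← Real.rpow_neg_one x, ← Real.rpow_add hx0]; norm_num
      rw [this]
      gcongr
      linarith
  have h1 : IntegrableOn (fun x : ℝ => |x| ^ (-(1/2) : ℝ) * (1 + |x|)⁻¹) (Iic 0) := by
    rw [← Measure.map_neg_eq_self (volume : Measure ℝ)]
    let m : MeasurableEmbedding fun x : ℝ => -x := (Homeomorph.neg ℝ).measurableEmbedding
    rw [m.integrableOn_map_iff]
    simp_rw [Function.comp_def, abs_neg, neg_preimage, neg_Iic, neg_zero]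
    exact Iff.mpr integrableOn_Ici_iff_integrableOn_Ioi h0
  rw [← integrableOn_univ, ← Iic_union_Ioi (a := (0:ℝ))]
  exact h1.union h0

open FourierTransform in
lemma tii_hat_eq (f : SchwartzMap ℝ ℂ) (ξ : ℝ) :
    fourierHat f ξ = (((2 * Real.pi : ℝ) ^ (-(1 : ℝ) / 2) : ℝ) : ℂ) *
      (𝓕 f : SchwartzMap ℝ ℂ) (ξ / (2 * Real.pi)) := by
  rw [fourierHat, SchwartzMap.fourier_coe, Real.fourier_eq']
  congr 2
  ext t
  rw [smul_eq_mul, mul_comm]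
  congr 2
  have : (Real.pi : ℂ) ≠ 0 := by exact_mod_cast Real.pi_ne_zero
  simp
  field_simp

lemma tii_hat_cont (f : SchwartzMap ℝ ℂ) : Continuous (fourierHat f) := by
  rw [show fourierHat f = _ from funext (tii_hat_eq f)]
  fun_prop

open FourierTransform in
lemma tii_hat_int (f : SchwartzMap ℝ ℂ) : Integrable (fourierHat f) := by
  rw [show fourierHat f = _ from funext (tii_hat_eq f)]
  refine Integrable.const_mul ?_ _
  exact (SchwartzMap.integrable (𝓕 f : SchwartzMap ℝ ℂ)).comp_div (by positivity)

open FourierTransform in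
lemma tii_hat_decay (f : SchwartzMap ℝ ℂ) :
    ∃ C : ℝ, 0 ≤ C ∧ ∀ ξ : ℝ, ‖fourierHat f ξ‖ ≤ C * (1 + |ξ|)⁻¹ := by
  obtain ⟨C0, h0, hC0⟩ := (𝓕 f : SchwartzMap ℝ ℂ).decay 0 0
  obtain ⟨C1, h1, hC1⟩ := (𝓕 f : SchwartzMap ℝ ℂ).decay 1 0
  have hpi := Real.pi_pos
  have hc : 0 < (2 * Real.pi : ℝ) ^ (-(1 : ℝ) / 2) := by positivity
  refine ⟨(2 * Real.pi : ℝ) ^ (-(1 : ℝ) / 2) * (C0 + 2 * Real.pi * C1), by positivity,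
    fun ξ => ?_⟩
  have a0 := hC0 (ξ / (2 * Real.pi))
  have a1 := hC1 (ξ / (2 * Real.pi))
  rw [tii_hat_eq, norm_mul, Complex.norm_real, Real.norm_of_nonneg hc.le, mul_assoc]
  gcongr
  rw [← div_eq_mul_inv, le_div_iff₀ (by positivity)]
  simp only [norm_iteratedFDeriv_zero, pow_zero, one_mul, pow_one, norm_div, Real.norm_eq_abs] at a0 a1
  rw [abs_of_pos (show 0 < 2 * Real.pi by positivity), div_mul_eq_mul_div, div_le_iff₀ (by positivity)] at a1
  nlinarith

open FourierTransform in
lemma tii_inv (f : SchwartzMap ℝ ℂ) (v : ℝ) :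
    ∫ ξ : ℝ, fourierHat f ξ * Complex.exp (-Complex.I * (v : ℂ) * (ξ : ℂ)) =
      (Real.sqrt (2 * Real.pi) : ℂ) * f (-v) := by
  have hpi := Real.pi_pos
  have h1 : (𝓕⁻ (𝓕 f : SchwartzMap ℝ ℂ) : SchwartzMap ℝ ℂ) (-v) = f (-v) := by
    rw [FourierTransform.fourierInv_fourier_eq]
  rw [SchwartzMap.fourierInv_coe, Real.fourierInv_eq'] at h1
  rw [← h1]
  have h2 := Measure.integral_comp_div (fun η : ℝ => (((2 * Real.pi : ℝ) ^ (-(1 : ℝ) / 2) : ℝ) : ℂ) *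
      (Complex.exp (((2 * Real.pi * inner ℝ η (-v) : ℝ) : ℂ) * Complex.I) •
        (𝓕 f : SchwartzMap ℝ ℂ) η)) (2 * Real.pi)
  rw [abs_of_pos (by positivity)] at h2
  have h3 : (Real.sqrt (2 * Real.pi)) = (2 * Real.pi) * (2 * Real.pi : ℝ) ^ (-(1 : ℝ) / 2) := by
    rw [Real.sqrt_eq_rpow]
    nth_rewrite 2 [← Real.rpow_one (2 * Real.pi)]
    rw [← Real.rpow_add (by positivity)]; norm_num
  rw [h3, Complex.ofReal_mul, mul_assoc, ← Complex.real_smul, ← integral_const_mul, ← h2]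
  congr 1
  ext ξ
  rw [tii_hat_eq, smul_eq_mul, mul_assoc, mul_comm (Complex.exp _)]
  congr 3
  have : (Real.pi : ℂ) ≠ 0 := by exact_mod_cast Real.pi_ne_zero
  simp
  field_simp

/-- kernel -/
lemma tii_ker (ξ : ℝ) (hξ : ξ ≠ 0) :
    ((Real.pi : ℂ) / (Complex.I * ξ)) ^ (1 / 2 : ℂ) = (Real.sqrt Real.pi : ℂ) / sqrtIPlusZero ξ := by
  have hpi := Real.pi_pos
  have key : ∀ (r : ℝ) (w θ : ℂ), 0 < r → w ≠ 0 → Complex.log w = θ →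
      (((Real.pi / r : ℝ) : ℂ) * w) ^ (1/2 : ℂ) =
        (Real.sqrt Real.pi : ℂ) / (Real.sqrt r : ℂ) * Complex.exp (θ / 2) := by
    intro r w θ hr hw hθ
    have hq : 0 < Real.pi / r := by positivity
    rw [cpow_def_of_ne_zero (mul_ne_zero (by exact_mod_cast hq.ne') hw),
      Complex.log_ofReal_mul hq hw, hθ, add_mul, Complex.exp_add]
    congr 1
    · rw [← Complex.ofReal_div, ← Real.sqrt_div hpi.le, Real.sqrt_eq_rpow,
        Real.rpow_def_of_pos hq]
      push_cast
      rfl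
    · congr 1; ring
  have hI := Complex.I_sq
  rcases lt_or_gt_of_ne hξ with h | h
  · have : (Real.pi : ℂ) / (Complex.I * ξ) = ((Real.pi / (-ξ) : ℝ) : ℂ) * Complex.I := by
      have : (ξ : ℂ) ≠ 0 := by exact_mod_cast hξ
      push_cast
      field_simp
      simp
    rw [this, key (-ξ) Complex.I _ (by linarith) Complex.I_ne_zero Complex.log_I, sqrtIPlusZero,
      abs_of_neg h, Real.sign_of_neg h, div_mul_eq_div_div, div_eq_mul_inv _ (Complex.exp _),
      ← Complex.exp_neg]
    congr 2
    push_cast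
    ring
  · have : (Real.pi : ℂ) / (Complex.I * ξ) = ((Real.pi / ξ : ℝ) : ℂ) * (-Complex.I) := by
      have : (ξ : ℂ) ≠ 0 := by exact_mod_cast hξ
      push_cast
      field_simp
      simp
    rw [this, key ξ (-Complex.I) _ h (by simp) Complex.log_neg_I, sqrtIPlusZero,
      abs_of_pos h, Real.sign_of_pos h, div_mul_eq_div_div, div_eq_mul_inv _ (Complex.exp _),
      ← Complex.exp_neg]
    congr 2
    push_cast
    ring

lemma tii_reg (f : SchwartzMap ℝ ℂ) (x ε : ℝ) (hε : 0 < ε) :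
    ∫ ξ : ℝ, fourierHat f ξ * ((Real.pi : ℂ) / (ε + Complex.I * ξ)) ^ (1 / 2 : ℂ) *
        Complex.exp (-Complex.I * (x : ℂ) * (ξ : ℂ)) =
    (Real.sqrt (2 * Real.pi) : ℂ) * ∫ y : ℝ, Complex.exp (-ε * y ^ 2) * f (-(x + y ^ 2)) := by
  have hint : Integrable (Function.uncurry fun (ξ y : ℝ) =>
      (fourierHat f ξ * Complex.exp (-ε * y ^ 2)) *
        Complex.exp (-Complex.I * ((x + y ^ 2 : ℝ) : ℂ) * (ξ : ℂ))) (volume.prod volume) := by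
    have h1 := (tii_hat_int f).mul_prod (integrable_cexp_neg_mul_sq (b := (ε : ℂ)) (by simpa using hε))
    refine h1.mul_bdd (c := 1) ?_ ?_
    · apply Continuous.aestronglyMeasurable
      fun_prop
    · refine ae_of_all _ fun z => ?_
      rw [Complex.norm_exp]
      simp only [← Complex.ofReal_mul, mul_assoc, neg_mul, Complex.neg_re, Complex.re_mul_ofReal, Complex.I_mul_re, Complex.ofReal_im]
      simp
  have hsw := integral_integral_swap hint
  have hl : ∀ ξ : ℝ, fourierHat f ξ * ((Real.pi : ℂ) / (ε + Complex.I * ξ)) ^ (1 / 2 : ℂ) *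
        Complex.exp (-Complex.I * (x : ℂ) * (ξ : ℂ)) = ∫ y : ℝ,
      (fourierHat f ξ * Complex.exp (-ε * y ^ 2)) *
        Complex.exp (-Complex.I * ((x + y ^ 2 : ℝ) : ℂ) * (ξ : ℂ)) := by
    intro ξ
    rw [← integral_gaussian_complex (b := ε + Complex.I * ξ) (by simpa using hε), mul_right_comm,
      ← integral_const_mul]
    congr 1
    ext y
    rw [mul_assoc, mul_assoc (fourierHat f ξ), ← Complex.exp_add, ← Complex.exp_add]
    congr 2
    push_cast
    ring
  simp_rw [hl]
  rw [hsw, ← integral_const_mul]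
  congr 1
  ext y
  have := tii_inv f (x + y ^ 2)
  rw [mul_left_comm, ← this, ← integral_const_mul]
  congr 1
  ext ξ
  ring

lemma tii_kmeas (ε : ℝ) : Measurable fun ξ : ℝ =>
    ((Real.pi : ℂ) / (ε + Complex.I * ξ)) ^ (1 / 2 : ℂ) := by fun_prop

lemma tii_knorm (ε ξ : ℝ) (hε : 0 < ε) : ‖((Real.pi : ℂ) / (ε + Complex.I * ξ)) ^ (1 / 2 : ℂ)‖
    ≤ Real.sqrt Real.pi * |ξ| ^ (-(1/2) : ℝ) ∨ ξ = 0 := by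
  by_cases h : ξ = 0
  · right; exact h
  left
  have h' : 0 < |ξ| := abs_pos.mpr h
  have hpi := Real.pi_pos
  have := Complex.norm_cpow_real ((Real.pi : ℂ) / (ε + Complex.I * ξ)) (1/2)
  push_cast at this
  rw [this, norm_div, Real.sqrt_eq_rpow, Real.rpow_neg h'.le, ← div_eq_mul_inv,
    ← Real.div_rpow hpi.le h'.le, Complex.norm_real, Real.norm_of_nonneg hpi.le]
  gcongr
  have := Complex.abs_im_le_norm (ε + Complex.I * ξ)
  simpa using this

lemma tii_inner (f : SchwartzMap ℝ ℂ) (x : ℝ) (hx : 0 < x) :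
    ∫ ξ : ℝ, (fourierHat f ξ / sqrtIPlusZero ξ) *
          Complex.exp (-Complex.I * (x : ℂ) * (ξ : ℂ)) =
      (Real.sqrt 2 : ℂ) * ∫ y : ℝ, f (-(x + y ^ 2)) := by
  have hpi := Real.pi_pos
  have ht : Tendsto (fun n : ℕ => 1 / ((n : ℝ) + 1)) atTop (nhds 0) :=
    tendsto_one_div_add_atTop_nhds_zero_nat
  have hpos : ∀ n : ℕ, 0 < 1 / ((n : ℝ) + 1) := fun n => by positivity
  obtain ⟨C, hC, hCd⟩ := tii_hat_decay f
  obtain ⟨D, hD, hDd⟩ := tii_decay f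
  have hae : ∀ᵐ ξ : ℝ, ξ ≠ 0 := by
    simp [ae_iff, measure_singleton]
  have L1 : Tendsto (fun n : ℕ => ∫ ξ : ℝ, fourierHat f ξ *
      ((Real.pi : ℂ) / ((1 / ((n : ℝ) + 1) : ℝ) + Complex.I * ξ)) ^ (1 / 2 : ℂ) *
        Complex.exp (-Complex.I * (x : ℂ) * (ξ : ℂ))) atTop
      (nhds (∫ ξ : ℝ, (Real.sqrt Real.pi : ℂ) * ((fourierHat f ξ / sqrtIPlusZero ξ) *
          Complex.exp (-Complex.I * (x : ℂ) * (ξ : ℂ))))) := by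
    refine tendsto_integral_of_dominated_convergence
      (fun ξ => (C * Real.sqrt Real.pi) * (|ξ| ^ (-(1/2) : ℝ) * (1 + |ξ|)⁻¹)) ?_
      (tii_intP.const_mul _) ?_ ?_
    · intro n
      refine Measurable.aestronglyMeasurable ?_
      exact ((tii_hat_cont f).measurable.mul (tii_kmeas _)).mul (by fun_prop)
    · intro n
      filter_upwards [hae] with ξ hξ
      have h1 := (tii_knorm _ ξ (hpos n)).resolve_right hξ
      have h2 : ‖Complex.exp (-Complex.I * (x : ℂ) * (ξ : ℂ))‖ = 1 := by
        rw [Complex.norm_exp]; simp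
      rw [norm_mul, h2, mul_one, norm_mul]
      calc _ ≤ (C * (1 + |ξ|)⁻¹) * (Real.sqrt Real.pi * |ξ| ^ (-(1/2) : ℝ)) :=
            mul_le_mul (hCd ξ) h1 (norm_nonneg _) (by positivity)
        _ = _ := by ring
    · filter_upwards [hae] with ξ hξ
      have e : (Real.sqrt Real.pi : ℂ) * ((fourierHat f ξ / sqrtIPlusZero ξ) *
          Complex.exp (-Complex.I * (x : ℂ) * (ξ : ℂ))) = fourierHat f ξ *
          ((Real.pi : ℂ) / (((0 : ℝ) : ℂ) + Complex.I * ξ)) ^ (1 / 2 : ℂ) *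
          Complex.exp (-Complex.I * (x : ℂ) * (ξ : ℂ)) := by
        rw [Complex.ofReal_zero, zero_add, tii_ker ξ hξ]; ring
      rw [e]
      refine Tendsto.mul_const _ (Tendsto.const_mul _ ?_)
      have hc : ContinuousAt (fun ε : ℝ =>
          ((Real.pi : ℂ) / ((ε : ℂ) + Complex.I * ξ)) ^ (1 / 2 : ℂ)) 0 := by
        have hne : ((0 : ℝ) : ℂ) + Complex.I * ξ ≠ 0 := by simpa using hξ
        refine ContinuousAt.cpow ?_ continuousAt_const ?_
        · refine ContinuousAt.div continuousAt_const (by fun_prop) hne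
        · right
          rw [Complex.div_im]
          simp [Complex.normSq_apply, hξ, hpi.ne']
      exact hc.tendsto.comp ht
  have L2 : Tendsto (fun n : ℕ => (Real.sqrt (2 * Real.pi) : ℂ) *
      ∫ y : ℝ, Complex.exp (-(1 / ((n : ℝ) + 1) : ℝ) * y ^ 2) * f (-(x + y ^ 2))) atTop
      (nhds ((Real.sqrt (2 * Real.pi) : ℂ) * ∫ y : ℝ, f (-(x + y ^ 2)))) := by
    refine Tendsto.const_mul _ ?_
    refine tendsto_integral_of_dominated_convergence (fun y => D * (1 + y ^ 2)⁻¹) ?_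
      (integrable_inv_one_add_sq.const_mul _) ?_ ?_
    · intro n
      apply Continuous.aestronglyMeasurable
      fun_prop
    · intro n
      refine ae_of_all _ fun y => ?_
      have h1 : ‖Complex.exp (-(1 / ((n : ℝ) + 1) : ℝ) * y ^ 2)‖ ≤ 1 := by
        rw [Complex.norm_exp, Real.exp_le_one_iff]
        have : (-((1 / ((n : ℝ) + 1) : ℝ) : ℂ) * (y : ℂ) ^ 2) = ((-(1 / ((n : ℝ) + 1)) * y ^ 2 : ℝ) : ℂ) := by
          push_cast; ring
        rw [this, Complex.ofReal_re]
        have := mul_nonneg (hpos n).le (sq_nonneg y)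
        linarith
      have h2 := hDd (x + y ^ 2) (by positivity)
      rw [norm_mul]
      refine (mul_le_of_le_one_left (norm_nonneg _) h1).trans (h2.trans ?_)
      have hy := sq_nonneg y
      gcongr
      calc 1 + y ^ 2 ≤ 1 + (x + y ^ 2) := by linarith
        _ ≤ _ := le_self_pow₀ (by linarith) (by norm_num)
    · refine ae_of_all _ fun y => ?_
      have hc : Continuous (fun ε : ℝ => Complex.exp (-ε * y ^ 2) * f (-(x + y ^ 2))) := by
        fun_prop
      have := (hc.tendsto 0).comp ht
      simpa [Function.comp_def] using this
  simp_rw [tii_reg f x _ (hpos _)] at L1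
  have := tendsto_nhds_unique L1 L2
  rw [integral_const_mul, Real.sqrt_mul (by norm_num), Complex.ofReal_mul,
    mul_comm (Real.sqrt 2 : ℂ), mul_assoc] at this
  exact mul_left_cancel₀ (by exact_mod_cast (Real.sqrt_pos.mpr hpi).ne') this

lemma tii_outer (f : SchwartzMap ℝ ℂ) :
    ∫ x in Ioi (0 : ℝ), ∫ y : ℝ, f (-(x + y ^ 2)) =
      ∫ x in Ioi (0 : ℝ), 2 * (((Real.sqrt x : ℝ) : ℂ) * f (-x)) := by
  obtain ⟨D, hD, hDd⟩ := tii_decay f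
  have hdom : Integrable (fun z : ℝ × ℝ => D * ((1 + z.1 ^ 2)⁻¹ * (1 + z.2 ^ 2)⁻¹))
      (volume.prod volume) :=
    (integrable_inv_one_add_sq.mul_prod integrable_inv_one_add_sq).const_mul D
  have hdom2 : Integrable (fun z : ℝ × ℝ => D * ((1 + z.1 ^ 2)⁻¹ * (1 + z.2 ^ 2)⁻¹))
      ((volume.restrict (Ioi 0)).prod volume) :=
    (integrable_inv_one_add_sq.restrict.mul_prod integrable_inv_one_add_sq).const_mul D
  have h1 : Integrable (Function.uncurry fun (x y : ℝ) => f (-(x + y ^ 2)))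
      ((volume.restrict (Ioi 0)).prod volume) := by
    refine hdom2.mono' ?_ ?_
    · apply Continuous.aestronglyMeasurable
      unfold Function.uncurry
      fun_prop
    · have : ∀ᵐ z : ℝ × ℝ ∂((volume.restrict (Ioi 0)).prod volume), z.1 ∈ Ioi (0 : ℝ) :=
        Measure.quasiMeasurePreserving_fst.ae (ae_restrict_mem measurableSet_Ioi)
      filter_upwards [this] with z hz
      have hz' : 0 < z.1 := hz
      refine (hDd (z.1 + z.2 ^ 2) (by positivity)).trans ?_
      rw [← mul_inv]
      gcongr
      have := sq_nonneg z.2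
      calc (1 + z.1 ^ 2) * (1 + z.2 ^ 2) ≤ (1 + (z.1 + z.2 ^ 2)) ^ 2 * (1 + (z.1 + z.2 ^ 2)) := by
            gcongr
            · nlinarith
            · linarith
        _ = _ := by ring
  rw [integral_integral_swap h1]
  have h2 : ∀ y : ℝ, ∫ x in Ioi (0 : ℝ), f (-(x + y ^ 2)) =
      ∫ u : ℝ, {z : ℝ × ℝ | z.1 ^ 2 < z.2}.indicator (fun z => f (-z.2)) (y, u) := by
    intro y
    have e : (fun u : ℝ => {z : ℝ × ℝ | z.1 ^ 2 < z.2}.indicator (fun z => f (-z.2)) (y, u)) =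
        (Ioi (y ^ 2)).indicator (fun u => f (-u)) := by
      ext u
      simp [indicator_apply]
    rw [e, integral_indicator measurableSet_Ioi, ← integral_indicator measurableSet_Ioi,
      ← integral_indicator measurableSet_Ioi,
      ← integral_add_right_eq_self ((Ioi (y ^ 2)).indicator (fun u => f (-u))) (y ^ 2)]
    congr 1
    ext u
    simp [indicator_apply]
  simp_rw [h2]
  have hms : MeasurableSet {z : ℝ × ℝ | z.1 ^ 2 < z.2} :=
    measurableSet_lt (by fun_prop) (by fun_prop)
  have h3 : Integrable (Function.uncurry fun (y u : ℝ) =>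
      {z : ℝ × ℝ | z.1 ^ 2 < z.2}.indicator (fun z => f (-z.2)) (y, u))
      (volume.prod volume) := by
    refine hdom.mono' ?_ ?_
    · have : AEStronglyMeasurable (fun z : ℝ × ℝ => f (-z.2)) (volume.prod volume) := by
        apply Continuous.aestronglyMeasurable
        fun_prop
      exact this.indicator hms
    · refine ae_of_all _ fun z => ?_
      change ‖{z : ℝ × ℝ | z.1 ^ 2 < z.2}.indicator (fun z => f (-z.2)) z‖ ≤ _
      by_cases hz : z.1 ^ 2 < z.2
      · rw [indicator_of_mem (by exact hz)]
        have := sq_nonneg z.1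
        have hz0 : 0 < z.2 := lt_of_le_of_lt this hz
        refine (hDd z.2 hz0.le).trans ?_
        rw [← mul_inv]
        gcongr
        calc (1 + z.1 ^ 2) * (1 + z.2 ^ 2) ≤ (1 + z.2) * (1 + z.2) ^ 2 := by
              gcongr
              nlinarith
          _ = _ := by ring
      · rw [indicator_of_notMem (by exact hz), norm_zero]
        positivity
  rw [integral_integral_swap h3, ← integral_indicator measurableSet_Ioi]
  congr 1
  ext u
  by_cases hu : 0 < u
  · rw [indicator_of_mem (by exact hu)]
    have e : (fun y : ℝ => {z : ℝ × ℝ | z.1 ^ 2 < z.2}.indicator (fun z => f (-z.2)) (y, u)) =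
        (Ioo (-Real.sqrt u) (Real.sqrt u)).indicator (fun _ => f (-u)) := by
      ext y
      simp only [indicator_apply, mem_ofPred_eq, mem_Ioo, Real.sq_lt]
    rw [e, integral_indicator measurableSet_Ioo, setIntegral_const, Complex.real_smul,
      Measure.real, Real.volume_Ioo, ENNReal.toReal_ofReal (by linarith [Real.sqrt_nonneg u])]
    push_cast
    ring
  · rw [indicator_of_notMem (by exact hu)]
    have e : (fun y : ℝ => {z : ℝ × ℝ | z.1 ^ 2 < z.2}.indicator (fun z => f (-z.2)) (y, u)) =
        fun _ => 0 := by
      ext y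
      refine indicator_of_notMem ?_ _
      have := sq_nonneg y
      simp only [mem_ofPred_eq]
      linarith
    rw [e, integral_zero]

/-- For every Schwartz function `f`, the iterated integral
(inner integral over `ξ ∈ ℝ` first, then over `x ∈ (0,∞)`) satisfies the exact
identity `(1/(√8 π)) ∫_0^∞ ∫_ℝ (f̂(ξ)/√(iξ+0)) e^{-ixξ} dξ dx
  = (1/π) ∫_0^∞ √x · f(−x) dx`. -/
theorem trace_integral_identity
    (f : SchwartzMap ℝ ℂ) :
    (1 / (Real.sqrt 8 * Real.pi) : ℂ) *
      ∫ x in Ioi (0 : ℝ), ∫ ξ : ℝ,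
        (fourierHat (⇑f) ξ / sqrtIPlusZero ξ) *
          Complex.exp (-Complex.I * (x : ℂ) * (ξ : ℂ))
    = (1 / Real.pi : ℂ) *
        ∫ x in Ioi (0 : ℝ), ((Real.sqrt x : ℝ) : ℂ) * f (-x) := by
  rw [setIntegral_congr_fun measurableSet_Ioi (fun x hx => tii_inner f x hx), integral_const_mul,
    tii_outer, integral_const_mul]
  have h8 : Real.sqrt 8 = 2 * Real.sqrt 2 := by
    rw [show (8 : ℝ) = 2 ^ 2 * 2 by norm_num, Real.sqrt_mul (by norm_num),
      Real.sqrt_sq (by norm_num)]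
  have h2 : (Real.sqrt 2 : ℂ) ≠ 0 := by
    exact_mod_cast (Real.sqrt_pos.mpr (by norm_num : (0:ℝ) < 2)).ne'
  have : (Real.pi : ℂ) ≠ 0 := by exact_mod_cast Real.pi_ne_zero
  rw [h8]
  push_cast
  field_simp
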